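/- Let A be an (n+2) × n real matrix, B an n × (n+2) real matrix, and suppose A·B = C where C is an (n+2) × (n+2) matrix of the form C[i][j] = aⱼ for i > j and C[j][j] = bⱼ, with aⱼ ≠ bⱼ for all j (entries above the diagonal arbitrary). Then we obtain a contradiction: rank(C) ≥ n+1 while rank(A·B) ≤ n, so no such factorization exists. -/

import Mathlib

/-- If, below the diagonal, each column of `C` is constant with a value different from the diagonal
entry of that column, then the consecutive row differences of `C`, without the last column, form
a nonsingular (upper triangular) matrix. -/
lemma det_sub_submatrix_ne_zero {R : Type*} [CommRing R] [IsDomain R] {m : ℕ}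
    {C : Matrix (Fin (m + 1)) (Fin (m + 1)) R} {a : Fin (m + 1) → R}
    (hlow : ∀ i j, j < i → C i j = a j) (hne : ∀ j, a j ≠ C j j) :
    (C.submatrix Fin.succ Fin.castSucc - C.submatrix Fin.castSucc Fin.castSucc).det ≠ 0 := by
  rw [Matrix.det_of_isUpperTriangular]
  · refine Finset.prod_ne_zero_iff.mpr fun i _ => ?_
    simpa [hlow _ _ i.castSucc_lt_succ, sub_eq_zero] using hne i.castSucc
  · intro i j hji
    have hji' : j < i := hji
    have h₁ : j.castSucc < i.castSucc := Fin.castSucc_lt_castSucc_iff.mpr hji'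
    simp [hlow _ _ h₁, hlow _ _ (h₁.trans i.castSucc_lt_succ)]

/-- A matrix as in `det_sub_submatrix_ne_zero` has corank at most one. -/
lemma le_rank_of_lower_const {K : Type*} [Field K] {m : ℕ}
    {C : Matrix (Fin (m + 1)) (Fin (m + 1)) K} {a : Fin (m + 1) → K}
    (hlow : ∀ i j, j < i → C i j = a j) (hne : ∀ j, a j ≠ C j j) : m ≤ C.rank := by
  set P : Matrix (Fin m) (Fin (m + 1)) K :=
    (1 : Matrix _ _ K).submatrix Fin.succ id - (1 : Matrix _ _ K).submatrix Fin.castSucc id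
  set Q : Matrix (Fin (m + 1)) (Fin m) K := (1 : Matrix _ _ K).submatrix id Fin.castSucc
  have hPQ : P * C * Q =
      C.submatrix Fin.succ Fin.castSucc - C.submatrix Fin.castSucc Fin.castSucc := by
    ext i j
    simp [P, Q, Matrix.mul_apply, Matrix.sub_apply, Matrix.one_apply, sub_mul]
  have hunit : IsUnit (P * C * Q) := by
    rw [Matrix.isUnit_iff_isUnit_det, isUnit_iff_ne_zero, hPQ]
    exact det_sub_submatrix_ne_zero hlow hne
  calc m = (P * C * Q).rank := by simp [Matrix.rank_of_isUnit _ hunit]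
    _ ≤ (P * C).rank := Matrix.rank_mul_le_left _ _
    _ ≤ C.rank := Matrix.rank_mul_le_right _ _

theorem stmt13 (n : ℕ) (A : Matrix (Fin (n + 2)) (Fin n) ℝ)
    (B : Matrix (Fin n) (Fin (n + 2)) ℝ)
    (C : Matrix (Fin (n + 2)) (Fin (n + 2)) ℝ) (a b : Fin (n + 2) → ℝ)
    (hlow : ∀ i j : Fin (n + 2), j < i → C i j = a j)
    (hdiag : ∀ j : Fin (n + 2), C j j = b j)
    (hne : ∀ j : Fin (n + 2), a j ≠ b j)
    (hAB : A * B = C) : False := by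
  have hge : n + 1 ≤ C.rank := le_rank_of_lower_const hlow fun j => by
    rw [hdiag]
    exact hne j
  have hle : C.rank ≤ n := by
    rw [← hAB]
    exact (Matrix.rank_mul_le_left A B).trans (Matrix.rank_le_width A)
  omega
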